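/- arXiv:1408.3001 — 2 statements merged into one kernel-verified Lean document; each statement's English description precedes it below -/
import Mathlib

section
/- (Lemma 2.6, bounded sublevel sets) Assume the potentials V_{ij} are C¹, T-periodic in t, and satisfy (V3), Gordon's strong force condition (V5), the symmetry (V6): V_{ij}(t + T/2, −ξ) = V_{ij}(t, ξ), and the growth condition (V4)': there exist g > 0, θ < 2 and r > 0 with V_{ij}(t, ξ) ≤ g·m_i·m_j·|ξ|^θ for all t and |ξ| > r. Then for every K ∈ ℝ there exists A ≥ 0 such that every T-periodic absolutely continuous non-collision path X = (x_1,…,x_N) with square-integrable derivative, satisfying x_i(t + T/2) = −x_i(t) for all i and f(X) ≤ K, obeys the kinetic energy bound ∑_{i=1}^N (m_i/2) ∫_0^T |ẋ_i(t)|² dt ≤ A. -/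
open MeasureTheory Filter

noncomputable section

/-- A `T`-periodic absolutely continuous path with square-integrable derivative:
`x` is `T`-periodic and is the integral of a `T`-periodic density `v` which is
square-integrable over one period. -/
def IsH1Loop {k : ℕ} (T : ℝ) (x : ℝ → EuclideanSpace ℝ (Fin k)) : Prop :=
  (∀ t, x (t + T) = x t) ∧
  ∃ v : ℝ → EuclideanSpace ℝ (Fin k),
    AEStronglyMeasurable v volume ∧
    (∀ t, v (t + T) = v t) ∧
    IntegrableOn (fun t => ‖v t‖ ^ 2) (Set.Icc 0 T) ∧
    ∀ s t : ℝ, x t - x s = ∫ u in s..t, v u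

/-- The total potential `V(t,x) = (1/2) ∑_{i ≠ j} V_{ij}(t, x_i - x_j)`. -/
def Vtot {N k : ℕ} (Vij : Fin N → Fin N → ℝ → EuclideanSpace ℝ (Fin k) → ℝ)
    (t : ℝ) (x : Fin N → EuclideanSpace ℝ (Fin k)) : ℝ :=
  (1 / 2) * ∑ i, ∑ j, if i ≠ j then Vij i j t (x i - x j) else 0

/-- The kinetic part of the action. -/
def kinetic {N k : ℕ} (T : ℝ) (m : Fin N → ℝ)
    (X : ℝ → Fin N → EuclideanSpace ℝ (Fin k)) : ℝ :=
  ∑ i, m i / 2 * ∫ t in (0:ℝ)..T, ‖deriv (fun s => X s i) t‖ ^ 2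

/-- The Lagrangian action of a `T`-periodic path. -/
def action {N k : ℕ} (T : ℝ) (m : Fin N → ℝ)
    (Vij : Fin N → Fin N → ℝ → EuclideanSpace ℝ (Fin k) → ℝ)
    (X : ℝ → Fin N → EuclideanSpace ℝ (Fin k)) : ℝ :=
  kinetic T m X - ∫ t in (0:ℝ)..T, Vtot Vij t (X t)

/-- A time-periodic potential, continuous away from the origin, nonpositive near the origin and of
subquadratic growth at infinity, is bounded above by a constant plus an arbitrarily small multiple
of the squared norm. -/
theorem exists_le_const_add_mul_sq_norm {E : Type*} [NormedAddCommGroup E] [ProperSpace E]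
    {W : ℝ → E → ℝ} {T : ℝ} (hT : 0 < T)
    (hW : ContinuousOn (fun p : ℝ × E => W p.1 p.2) (Set.univ ×ˢ {(0 : E)}ᶜ))
    (hper : ∀ t ξ, W (t + T) ξ = W t ξ)
    (hzero : ∃ δ > (0 : ℝ), ∀ t ξ, ξ ≠ 0 → ‖ξ‖ < δ → W t ξ ≤ 0)
    {c θ r : ℝ} (hθ : θ < 2) (hgrowth : ∀ t ξ, r < ‖ξ‖ → W t ξ ≤ c * ‖ξ‖ ^ θ)
    {ε : ℝ} (hε : 0 < ε) :
    ∃ C : ℝ, 0 ≤ C ∧ ∀ t ξ, ξ ≠ 0 → W t ξ ≤ C + ε * ‖ξ‖ ^ 2 := by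
  obtain ⟨δ, hδ, hzero⟩ := hzero
  have hlim : Tendsto (fun x : ℝ => c * x ^ (-(2 - θ))) atTop (nhds (c * 0)) :=
    (tendsto_rpow_neg_atTop (by linarith)).const_mul c
  rw [mul_zero] at hlim
  obtain ⟨R, hR⟩ := eventually_atTop.1
    (((hlim.eventually_lt_const hε).and (eventually_gt_atTop r)).and (eventually_gt_atTop 0))
  set S : Set (ℝ × E) := Set.Icc 0 T ×ˢ (Metric.closedBall 0 R ∩ {ξ | δ ≤ ‖ξ‖}) with hS
  have hScpt : IsCompact S := isCompact_Icc.prod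
    ((isCompact_closedBall 0 R).inter_right (isClosed_le continuous_const continuous_norm))
  have hSsub : S ⊆ Set.univ ×ˢ {(0 : E)}ᶜ := by
    rintro ⟨t, ξ⟩ ⟨-, -, hξ⟩
    refine ⟨trivial, ?_⟩
    rintro rfl
    simp only [Set.mem_ofPred_eq, norm_zero] at hξ
    linarith
  obtain ⟨B, hB⟩ := hScpt.bddAbove_image (hW.mono hSsub)
  refine ⟨max B 0, le_max_right _ _, fun t ξ hξ => ?_⟩
  have hsq : 0 ≤ ε * ‖ξ‖ ^ 2 := by positivity
  have hC : 0 ≤ max B 0 := le_max_right _ _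
  rcases lt_or_ge ‖ξ‖ δ with h | h
  · linarith [hzero t ξ hξ h]
  rcases lt_or_ge R ‖ξ‖ with h' | h'
  · obtain ⟨⟨h1, h2⟩, h3⟩ := hR ‖ξ‖ h'.le
    have hpow : ‖ξ‖ ^ θ = ‖ξ‖ ^ (-(2 - θ)) * ‖ξ‖ ^ 2 := by
      rw [← Real.rpow_natCast, ← Real.rpow_add h3]
      norm_num
    have := hgrowth t ξ h2
    rw [hpow, ← mul_assoc] at this
    have := mul_le_mul_of_nonneg_right h1.le (sq_nonneg ‖ξ‖)
    linarith
  · have hWper : Function.Periodic (fun s => W s ξ) T := fun s => hper s ξ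
    obtain ⟨s, hs, hst⟩ := hWper.exists_mem_Ico₀ hT t
    have : W s ξ ≤ B := hB ⟨(s, ξ), ⟨⟨hs.1, hs.2.le⟩, by simpa using h', h⟩, rfl⟩
    have hst : W t ξ = W s ξ := hst
    linarith [le_max_left B 0]

/-- The Cauchy–Schwarz inequality against the constant function on `[0, T]`. -/
theorem sq_intervalIntegral_le_mul_intervalIntegral_sq {T : ℝ} (hT : 0 < T) {u : ℝ → ℝ}
    (hu : IntervalIntegrable u volume 0 T)
    (hu2 : IntervalIntegrable (fun t => u t ^ 2) volume 0 T) :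
    (∫ t in (0:ℝ)..T, u t) ^ 2 ≤ T * ∫ t in (0:ℝ)..T, u t ^ 2 := by
  set I := ∫ t in (0:ℝ)..T, u t with hI
  have hnonneg : 0 ≤ ∫ t in (0:ℝ)..T, (u t - I / T) ^ 2 :=
    intervalIntegral.integral_nonneg hT.le fun t _ => sq_nonneg _
  have hexpand : ∫ t in (0:ℝ)..T, (u t - I / T) ^ 2
      = (∫ t in (0:ℝ)..T, u t ^ 2) - 2 * (I / T) * I + T * (I / T) ^ 2 := by
    have : (fun t => (u t - I / T) ^ 2)
        = fun t => u t ^ 2 - 2 * (I / T) * u t + (I / T) ^ 2 := by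
      funext t; ring
    rw [this, intervalIntegral.integral_add (hu2.sub (hu.const_mul _)) (by simp),
      intervalIntegral.integral_sub hu2 (hu.const_mul _), intervalIntegral.integral_const_mul]
    simp [hI]
  rw [hexpand] at hnonneg
  have h := mul_nonneg hT.le hnonneg
  have h' : T * ((∫ t in (0:ℝ)..T, u t ^ 2) - 2 * (I / T) * I + T * (I / T) ^ 2)
      = T * (∫ t in (0:ℝ)..T, u t ^ 2) - I ^ 2 := by
    field_simp
    ring
  linarith

/-- A periodic function which is square-integrable over one period is integrable on every bounded
interval. -/
theorem intervalIntegrable_of_periodic_of_sq_norm {E : Type*} [NormedAddCommGroup E] {T : ℝ}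
    (hT : 0 < T) {v : ℝ → E} (hvm : AEStronglyMeasurable v volume) (hvper : ∀ t, v (t + T) = v t)
    (hv2 : IntegrableOn (fun t => ‖v t‖ ^ 2) (Set.Icc 0 T)) (a b : ℝ) :
    IntervalIntegrable v volume a b := by
  refine Function.Periodic.intervalIntegrable₀ hvper hT.ne' ?_ a b
  rw [intervalIntegrable_iff_integrableOn_Icc_of_le hT.le]
  exact ((memLp_two_iff_integrable_sq_norm hvm.restrict).2 hv2).integrable (by norm_num)

theorem IsH1Loop.continuous {k : ℕ} {T : ℝ} (hT : 0 < T) {x : ℝ → EuclideanSpace ℝ (Fin k)}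
    (hx : IsH1Loop T x) : Continuous x := by
  obtain ⟨-, v, hvm, hvper, hv2, hxv⟩ := hx
  have hvint := intervalIntegrable_of_periodic_of_sq_norm hT hvm hvper hv2
  have : x = fun t => x 0 + ∫ u in (0:ℝ)..t, v u := by
    funext t
    rw [← hxv 0 t]
    abel
  rw [this]
  exact continuous_const.add (intervalIntegral.continuous_primitive hvint 0)

/-- The Poincaré–Wirtinger type inequality for antiperiodic loops. -/
theorem IsH1Loop.sq_norm_le {k : ℕ} {T : ℝ} (hT : 0 < T) {x : ℝ → EuclideanSpace ℝ (Fin k)}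
    (hx : IsH1Loop T x) (hanti : ∀ t, x (t + T / 2) = -x t) (t : ℝ) :
    ‖x t‖ ^ 2 ≤ T / 4 * ∫ s in (0:ℝ)..T, ‖deriv x s‖ ^ 2 := by
  obtain ⟨-, v, hvm, hvper, hv2, hxv⟩ := hx
  have hvint := intervalIntegrable_of_periodic_of_sq_norm hT hvm hvper hv2
  have hderiv : ∀ᵐ s, deriv x s = v s := by
    have hloc : LocallyIntegrable v volume := by
      rw [locallyIntegrable_iff]
      intro K hK
      obtain ⟨a, b, hab⟩ : ∃ a b, K ⊆ Set.Ioc a b := by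
        obtain ⟨a, ha⟩ := hK.bddBelow
        obtain ⟨b, hb⟩ := hK.bddAbove
        exact ⟨a - 1, b, fun y hy => ⟨by linarith [ha hy], hb hy⟩⟩
      exact (hvint a b).1.mono_set hab
    filter_upwards [LocallyIntegrable.ae_hasDerivAt_integral hloc] with s hs
    have : x = fun t => x 0 + ∫ u in (0:ℝ)..t, v u := by
      funext t
      rw [← hxv 0 t]
      abel
    rw [this]
    exact ((hs 0).const_add (x 0)).deriv
  have hS : ∫ s in (0:ℝ)..T, ‖deriv x s‖ ^ 2 = ∫ s in (0:ℝ)..T, ‖v s‖ ^ 2 := by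
    refine intervalIntegral.integral_congr_ae ?_
    filter_upwards [hderiv] with s hs _
    rw [hs]
  have hCS := sq_intervalIntegral_le_mul_intervalIntegral_sq hT (hvint 0 T).norm
    ((intervalIntegrable_iff_integrableOn_Icc_of_le hT.le).2 hv2)
  have hhalf : 2 * ‖x t‖ ≤ ∫ s in (0:ℝ)..T, ‖v s‖ := by
    have hper : Function.Periodic (fun s => ‖v s‖) T := fun s => by simp only [hvper s]
    calc 2 * ‖x t‖ = ‖x (t + T / 2) - x t‖ := by
          rw [hanti, show -x t - x t = (-2 : ℝ) • x t by rw [neg_smul, two_smul]; abel, norm_smul]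
          norm_num
      _ = ‖∫ s in t..t + T / 2, v s‖ := by rw [hxv]
      _ ≤ ∫ s in t..t + T / 2, ‖v s‖ :=
          intervalIntegral.norm_integral_le_integral_norm (by linarith)
      _ ≤ ∫ s in t..t + T, ‖v s‖ := by
          refine intervalIntegral.integral_mono_interval le_rfl (by linarith) (by linarith)
            (ae_of_all _ fun s => norm_nonneg _) (hvint _ _).norm
      _ = ∫ s in (0:ℝ)..T, ‖v s‖ := by
          simpa using hper.intervalIntegral_add_eq t 0
  rw [hS]
  nlinarith [norm_nonneg (x t)]

theorem intervalIntegral_sq_norm_deriv_le_kinetic {N k : ℕ} {T : ℝ} (hT : 0 < T) {m : Fin N → ℝ}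
    (hm : ∀ i, 0 < m i) (X : ℝ → Fin N → EuclideanSpace ℝ (Fin k)) (i : Fin N) :
    ∫ t in (0:ℝ)..T, ‖deriv (fun s => X s i) t‖ ^ 2 ≤ 2 * (m i)⁻¹ * kinetic T m X := by
  have hnonneg : ∀ j, 0 ≤ ∫ t in (0:ℝ)..T, ‖deriv (fun s => X s j) t‖ ^ 2 := fun j =>
    intervalIntegral.integral_nonneg hT.le fun t _ => sq_nonneg _
  have hle : m i / 2 * ∫ t in (0:ℝ)..T, ‖deriv (fun s => X s i) t‖ ^ 2 ≤ kinetic T m X :=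
    Finset.single_le_sum
      (f := fun j => m j / 2 * ∫ t in (0:ℝ)..T, ‖deriv (fun s => X s j) t‖ ^ 2)
      (fun j _ => mul_nonneg (by linarith [hm j]) (hnonneg j)) (Finset.mem_univ i)
  have hmi := hm i
  calc _ = 2 * (m i)⁻¹ * (m i / 2 * ∫ t in (0:ℝ)..T, ‖deriv (fun s => X s i) t‖ ^ 2) := by
        field_simp
    _ ≤ _ := mul_le_mul_of_nonneg_left hle (by positivity)

theorem continuous_Vtot_comp {N k : ℕ}
    {Vij : Fin N → Fin N → ℝ → EuclideanSpace ℝ (Fin k) → ℝ}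
    (hV : ∀ i j, i ≠ j → ContinuousOn (fun p : ℝ × EuclideanSpace ℝ (Fin k) => Vij i j p.1 p.2)
      (Set.univ ×ˢ {(0 : EuclideanSpace ℝ (Fin k))}ᶜ))
    {X : ℝ → Fin N → EuclideanSpace ℝ (Fin k)} (hX : ∀ i, Continuous fun t => X t i)
    (hne : ∀ t, ∀ i j, i ≠ j → X t i ≠ X t j) :
    Continuous fun t => Vtot Vij t (X t) := by
  unfold Vtot
  refine continuous_const.mul
    (continuous_finsetSum _ fun i _ => continuous_finsetSum _ fun j _ => ?_)
  by_cases hij : i = j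
  · simpa [hij] using continuous_const
  · simp only [ne_eq, hij, not_false_eq_true, if_true]
    exact (hV i j hij).comp_continuous (continuous_id.prodMk ((hX i).sub (hX j)))
      fun t => ⟨trivial, sub_ne_zero.2 (hne t i j hij)⟩

theorem kinetic_energy_bounded_on_sublevels
    {N k : ℕ} (hN : 2 ≤ N) (hk : 2 ≤ k)
    (T : ℝ) (hT : 0 < T)
    (m : Fin N → ℝ) (hm : ∀ i, 0 < m i)
    (Vij : Fin N → Fin N → ℝ → EuclideanSpace ℝ (Fin k) → ℝ)
    -- each `V_{ij}` is `C¹` on `ℝ × (ℝ^k ∖ {0})`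
    (hC1 : ∀ i j, i ≠ j →
      ContDiffOn ℝ 1 (fun p : ℝ × EuclideanSpace ℝ (Fin k) => Vij i j p.1 p.2)
        (Set.univ ×ˢ {(0 : EuclideanSpace ℝ (Fin k))}ᶜ))
    -- `T`-periodicity in time
    (hper : ∀ i j t ξ, Vij i j (t + T) ξ = Vij i j t ξ)
    -- (V3): `V_{ij}(t,ξ) → -∞` uniformly in `t` as `|ξ| → 0`
    (hV3 : ∀ i j, i ≠ j → ∀ M : ℝ, ∃ δ > (0:ℝ), ∀ t : ℝ,
      ∀ ξ : EuclideanSpace ℝ (Fin k), ξ ≠ 0 → ‖ξ‖ < δ → Vij i j t ξ < -M)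
    -- (V5): Gordon's strong force condition
    (hV5 : ∀ i j, i ≠ j → ∃ 𝒩 : Set (EuclideanSpace ℝ (Fin k)),
      IsOpen 𝒩 ∧ (0 : EuclideanSpace ℝ (Fin k)) ∈ 𝒩 ∧
      ∃ U : EuclideanSpace ℝ (Fin k) → ℝ, ContDiffOn ℝ 1 U (𝒩 \ {0}) ∧
        Tendsto U (nhdsWithin 0 (𝒩 \ {0})) atTop ∧
        ∀ t : ℝ, ∀ ξ ∈ 𝒩 \ {0}, ‖gradient U ξ‖ ^ 2 ≤ -Vij i j t ξ)
    -- (V6): the symmetry `V_{ij}(t + T/2, -ξ) = V_{ij}(t, ξ)`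
    (hV6 : ∀ i j t ξ, Vij i j (t + T / 2) (-ξ) = Vij i j t ξ)
    -- (V4)': sub-quadratic growth at infinity
    (hV4' : ∃ g > (0:ℝ), ∃ θ < (2:ℝ), ∃ r > (0:ℝ), ∀ i j, i ≠ j →
      ∀ (t : ℝ) (ξ : EuclideanSpace ℝ (Fin k)), r < ‖ξ‖ →
        Vij i j t ξ ≤ g * m i * m j * ‖ξ‖ ^ θ) :
    ∀ K : ℝ, ∃ A ≥ (0:ℝ), ∀ X : ℝ → Fin N → EuclideanSpace ℝ (Fin k),
      (∀ i, IsH1Loop T fun t => X t i) →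
      (∀ t i, X (t + T / 2) i = -X t i) →
      (∀ t, ∀ i j, i ≠ j → X t i ≠ X t j) →
      action T m Vij X ≤ K →
      kinetic T m X ≤ A := by
  intro K
  obtain ⟨g, -, θ, hθ, r, -, hgrowth⟩ := hV4'
  have hVcont := fun i j hij => (hC1 i j hij).continuousOn
  set M : ℝ := ∑ i, (m i)⁻¹ with hM
  have hM0 : 0 ≤ M := Finset.sum_nonneg fun i _ => (inv_pos.2 (hm i)).le
  set b : ℝ := T * N ^ 2 * (T * M) with hb
  have hb0 : 0 ≤ b := by positivity
  obtain ⟨ε, hε, hεb⟩ : ∃ ε > (0 : ℝ), ε * b ≤ 1 / 2 := by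
    refine ⟨1 / (2 * (b + 1)), by positivity, ?_⟩
    rw [div_mul_eq_mul_div, div_le_div_iff₀ (by positivity) (by norm_num)]
    linarith
  have hbound : ∀ i j, ∃ C : ℝ, 0 ≤ C ∧
      (i ≠ j → ∀ t ξ, ξ ≠ 0 → Vij i j t ξ ≤ C + ε * ‖ξ‖ ^ 2) := by
    intro i j
    by_cases hij : i = j
    · exact ⟨0, le_rfl, fun h => absurd hij h⟩
    · obtain ⟨δ, hδ, hzero⟩ := hV3 i j hij 0
      obtain ⟨C, hC, h⟩ := exists_le_const_add_mul_sq_norm hT (hVcont i j hij) (hper i j)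
        ⟨δ, hδ, fun t ξ hξ hlt => by simpa using (hzero t ξ hξ hlt).le⟩ hθ (hgrowth i j hij) hε
      exact ⟨C, hC, fun _ => h⟩
  choose C hC0 hC using hbound
  set D : ℝ := ∑ i, ∑ j, C i j with hD
  refine ⟨max 0 (2 * (K + T * (D / 2))), le_max_left _ _, fun X hX hanti hne hact => ?_⟩
  refine le_max_of_le_right ?_
  have hXcont : ∀ i, Continuous fun t => X t i := fun i => (hX i).continuous hT
  have hkin0 : 0 ≤ kinetic T m X := Finset.sum_nonneg fun i _ =>
    mul_nonneg (by linarith [hm i])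
      (intervalIntegral.integral_nonneg hT.le fun t _ => sq_nonneg _)
  have hXsq : ∀ t i, ‖X t i‖ ^ 2 ≤ T * M / 2 * kinetic T m X := by
    intro t i
    have hiM : (m i)⁻¹ ≤ M := Finset.single_le_sum (f := fun j => (m j)⁻¹)
      (fun j _ => (inv_pos.2 (hm j)).le) (Finset.mem_univ i)
    calc ‖X t i‖ ^ 2 ≤ T / 4 * ∫ s in (0:ℝ)..T, ‖deriv (fun s => X s i) s‖ ^ 2 :=
          (hX i).sq_norm_le hT (fun t => hanti t i) t
      _ ≤ T / 4 * (2 * (m i)⁻¹ * kinetic T m X) := mul_le_mul_of_nonneg_left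
          (intervalIntegral_sq_norm_deriv_le_kinetic hT hm X i) (by positivity)
      _ ≤ T / 4 * (2 * M * kinetic T m X) := by gcongr
      _ = T * M / 2 * kinetic T m X := by ring
  have hVle : ∀ t, Vtot Vij t (X t) ≤ D / 2 + N ^ 2 * (ε * (T * M)) * kinetic T m X := by
    intro t
    have hterm : ∀ i j, (if i ≠ j then Vij i j t (X t i - X t j) else 0)
        ≤ C i j + ε * (2 * (T * M) * kinetic T m X) := by
      intro i j
      split_ifs with hij
      · refine (hC i j hij t _ (sub_ne_zero.2 (hne t i j hij))).trans ?_
        gcongr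
        have hpar := parallelogram_law_with_norm ℝ (X t i) (X t j)
        nlinarith [hXsq t i, hXsq t j, sq_nonneg ‖X t i + X t j‖]
      · have := hC0 i j
        positivity
    calc Vtot Vij t (X t)
        ≤ 1 / 2 * ∑ i, ∑ j, (C i j + ε * (2 * (T * M) * kinetic T m X)) := by
          unfold Vtot
          gcongr with i _ j _
          exact hterm i j
      _ = _ := by
          simp only [Finset.sum_add_distrib, Finset.sum_const, Finset.card_univ, Fintype.card_fin,
            nsmul_eq_mul, ← hD]
          ring
  have hint : ∫ t in (0:ℝ)..T, Vtot Vij t (X t)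
      ≤ T * (D / 2 + N ^ 2 * (ε * (T * M)) * kinetic T m X) := by
    calc ∫ t in (0:ℝ)..T, Vtot Vij t (X t)
        ≤ ∫ _ in (0:ℝ)..T, (D / 2 + N ^ 2 * (ε * (T * M)) * kinetic T m X) :=
          intervalIntegral.integral_mono_on hT.le
            ((continuous_Vtot_comp hVcont hXcont hne).intervalIntegrable 0 T) (by simp)
            fun t _ => hVle t
      _ = _ := by rw [intervalIntegral.integral_const, sub_zero, smul_eq_mul]
  have hhalf : T * (N ^ 2 * (ε * (T * M)) * kinetic T m X) ≤ 1 / 2 * kinetic T m X :=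
    calc _ = ε * b * kinetic T m X := by rw [hb]; ring
      _ ≤ _ := mul_le_mul_of_nonneg_right hεb hkin0
  unfold action at hact
  linarith

end
end

section
/- (Coercivity estimate away from collisions) Let m_1,…,m_N > 0, g > 0, 0 ≤ θ < 2, r > 0, and assume each V_{ij} satisfies V_{ij}(t, ξ) ≤ g·m_i·m_j·|ξ|^θ for all t and all |ξ| > r. Let X = (x_1,…,x_N) be a T-periodic absolutely continuous path with square-integrable derivative, satisfying x_i(t + T/2) = −x_i(t) for all i, such that |x_i(t) − x_j(t)| > r for all t ∈ [0, T] and all i ≠ j. Then, with kinetic energy K(X) = ∑_i (m_i/2) ∫_0^T |ẋ_i|² dt, the action satisfies f(X) ≥ K(X) − C·K(X)^{θ/2}, where C = g·(∑_{i<j} m_i m_j)^{(2−θ)/2}·(∑_i m_i)^{θ/2}·(T/(2π))^θ·T^{1−θ/2}·2^{θ/2}. -/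
open MeasureTheory Filter Real

noncomputable section

/-- Dirichlet form of Wirtinger's inequality with a subcritical frequency. -/
theorem sq_mul_integral_sq_le_of_lt {u w : ℝ → ℝ} {a b ω : ℝ} (hab : a < b)
    (hw : IntervalIntegrable w volume a b)
    (hw2 : IntervalIntegrable (fun t => w t ^ 2) volume a b)
    (hu : ∀ t, u t - u a = ∫ s in a..t, w s) (hua : u a = 0) (hub : u b = 0)
    (hω : 0 < ω) (hωπ : ω * (b - a) < π) :
    ω ^ 2 * ∫ t in a..b, u t ^ 2 ≤ ∫ t in a..b, w t ^ 2 := by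
  have hu' : u = fun t => ∫ s in a..t, w s := by
    funext t; rw [← hu t, hua, sub_zero]
  have hac : AbsolutelyContinuousOnInterval u a b := by
    rw [hu']
    exact hw.absolutelyContinuousOnInterval_intervalIntegral (by simp)
  have hderiv : ∀ᵐ x, x ∈ Set.uIcc a b → HasDerivAt u (w x) x := by
    filter_upwards [hw.ae_hasDerivAt_integral] with x hx hxm
    rw [hu']
    exact hx hxm a (by simp)
  set c := (a + b) / 2 with hc
  set G : ℝ → ℝ := fun t => ω * tan (ω * (t - c)) with hG
  have hcos : ∀ x ∈ Set.uIcc a b, cos (ω * (x - c)) ≠ 0 := by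
    intro x hx
    rw [Set.uIcc_of_le hab.le] at hx
    refine (cos_pos_of_mem_Ioo ⟨?_, ?_⟩).ne'
    · nlinarith [mul_le_mul_of_nonneg_left hx.1 hω.le]
    · nlinarith [mul_le_mul_of_nonneg_left hx.2 hω.le]
  have hGd : ∀ x ∈ Set.uIcc a b, HasDerivAt G (ω ^ 2 + G x ^ 2) x := by
    intro x hx
    have h1 : HasDerivAt (fun t => ω * (t - c)) ω x := by
      simpa using ((hasDerivAt_id x).sub_const c).const_mul ω
    have h2 := ((hasDerivAt_tan (hcos x hx)).comp x h1).const_mul ω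
    convert! h2 using 1
    have h3 : (1 : ℝ) / cos (ω * (x - c)) ^ 2 = 1 + tan (ω * (x - c)) ^ 2 := by
      rw [one_div, ← inv_one_add_tan_sq (hcos x hx), inv_inv]
    rw [h3, hG]
    ring
  have hGac : AbsolutelyContinuousOnInterval G a b := by
    refine ContDiffOn.absolutelyContinuousOnInterval fun x hx => ?_
    have h1 : ContDiffAt ℝ 1 (fun t => ω * (t - c)) x := by fun_prop
    have h2 : ContDiffAt ℝ 1 tan (ω * (x - c)) := contDiffAt_tan.2 (hcos x hx)
    exact (contDiffAt_const.mul (h2.comp x h1)).contDiffWithinAt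
  have huc : ContinuousOn u (Set.uIcc a b) := hac.continuousOn
  have hGc : ContinuousOn G (Set.uIcc a b) := hGac.continuousOn
  have hF := ((hac.mul hac).mul hGac).integral_deriv_eq_sub
  have hFd : ∀ᵐ x, x ∈ Set.uIoc a b →
      deriv (u * u * G) x = 2 * (u x * G x) * w x + u x ^ 2 * (ω ^ 2 + G x ^ 2) := by
    filter_upwards [hderiv] with x hx hxm
    have hxm' := Set.uIoc_subset_uIcc hxm
    rw [(((hx hxm').mul (hx hxm')).mul (hGd x hxm')).deriv]
    simp only [Pi.mul_apply]
    ring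
  rw [intervalIntegral.integral_congr_ae hFd] at hF
  simp only [Pi.mul_apply, hua, hub, zero_mul, sub_zero] at hF
  have i1 : IntervalIntegrable (fun x => 2 * (u x * G x) * w x) volume a b :=
    hw.continuousOn_mul (continuousOn_const.mul (huc.mul hGc))
  have i2 : IntervalIntegrable (fun x => u x ^ 2 * (ω ^ 2 + G x ^ 2)) volume a b :=
    ((huc.pow 2).mul (continuousOn_const.add (hGc.pow 2))).intervalIntegrable
  have i3 : IntervalIntegrable (fun x => ω ^ 2 * u x ^ 2) volume a b :=
    (continuousOn_const.mul (huc.pow 2)).intervalIntegrable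
  have hnn : 0 ≤ ∫ x in a..b, (w x ^ 2 - ω ^ 2 * u x ^ 2 +
      (2 * (u x * G x) * w x + u x ^ 2 * (ω ^ 2 + G x ^ 2))) := by
    refine intervalIntegral.integral_nonneg hab.le fun x _ => ?_
    nlinarith [sq_nonneg (w x + u x * G x)]
  rw [intervalIntegral.integral_add (hw2.sub i3) (i1.add i2), hF,
    intervalIntegral.integral_sub hw2 i3, intervalIntegral.integral_const_mul] at hnn
  linarith

/-- Wirtinger's inequality for functions vanishing at both ends of an interval. -/
theorem integral_sq_le_of_eq_zero_of_eq_zero {u w : ℝ → ℝ} {a b : ℝ} (hab : a < b)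
    (hw : IntervalIntegrable w volume a b)
    (hw2 : IntervalIntegrable (fun t => w t ^ 2) volume a b)
    (hu : ∀ t, u t - u a = ∫ s in a..t, w s) (hua : u a = 0) (hub : u b = 0) :
    (π / (b - a)) ^ 2 * ∫ t in a..b, u t ^ 2 ≤ ∫ t in a..b, w t ^ 2 := by
  have hba : 0 < b - a := sub_pos.2 hab
  have hpos : 0 < π / (b - a) := div_pos pi_pos hba
  have hlim : Tendsto (fun ω : ℝ => ω ^ 2 * ∫ t in a..b, u t ^ 2)
      (nhdsWithin (π / (b - a)) (Set.Iio (π / (b - a))))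
      (nhds ((π / (b - a)) ^ 2 * ∫ t in a..b, u t ^ 2)) :=
    ((continuous_id.pow 2).mul continuous_const).continuousAt.mono_left nhdsWithin_le_nhds
  refine le_of_tendsto hlim ?_
  filter_upwards [Ioo_mem_nhdsLT hpos] with ω hω
  exact sq_mul_integral_sq_le_of_lt hab hw hw2 hu hua hub hω.1 ((lt_div_iff₀ hba).1 hω.2)

/-- Wirtinger's inequality for real functions that change sign under a half-period shift. -/
theorem integral_sq_le_of_antiperiodic {u w : ℝ → ℝ} {T : ℝ} (hT : 0 < T)
    (hw : ∀ a b, IntervalIntegrable w volume a b)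
    (hw2 : ∀ a b, IntervalIntegrable (fun t => w t ^ 2) volume a b)
    (hwT : Function.Periodic w T) (hu : ∀ s t, u t - u s = ∫ r in s..t, w r)
    (hanti : Function.Antiperiodic u (T / 2)) :
    ∫ t in (0 : ℝ)..T, u t ^ 2 ≤ (T / (2 * π)) ^ 2 * ∫ t in (0 : ℝ)..T, w t ^ 2 := by
  have huc : Continuous u := by
    have : u = fun t => u 0 + ∫ r in (0 : ℝ)..t, w r := by
      funext t; rw [← hu]; ring
    rw [this]
    exact continuous_const.add (intervalIntegral.continuous_primitive hw 0)
  have huT : Function.Periodic u T := by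
    simpa [mul_div_cancel₀] using hanti.periodic_two_mul
  obtain ⟨c, hc⟩ : ∃ c, u c = 0 := by
    have h0 : u (T / 2) = -u 0 := by simpa using hanti 0
    rcases le_total (u 0) 0 with h | h
    · exact mem_range_of_exists_le_of_exists_ge huc ⟨0, h⟩ ⟨T / 2, by linarith⟩
    · exact mem_range_of_exists_le_of_exists_ge huc ⟨T / 2, by linarith⟩ ⟨0, h⟩
  have hc1 : u (c + T / 2) = 0 := by rw [hanti c, hc, neg_zero]
  have hc2 : u (c + T) = 0 := by rw [huT c, hc]
  have e1 := integral_sq_le_of_eq_zero_of_eq_zero (a := c) (b := c + T / 2) (by linarith)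
    (hw _ _) (hw2 _ _) (hu c) hc hc1
  have e2 := integral_sq_le_of_eq_zero_of_eq_zero (a := c + T / 2) (b := c + T) (by linarith)
    (hw _ _) (hw2 _ _) (hu _) hc1 hc2
  rw [show c + T / 2 - c = T / 2 by ring] at e1
  rw [show c + T - (c + T / 2) = T / 2 by ring] at e2
  have iu : ∀ a b, IntervalIntegrable (fun t => u t ^ 2) volume a b :=
    fun a b => (huc.pow 2).intervalIntegrable a b
  have p1 := (huT.comp (fun x => x ^ 2)).intervalIntegral_add_eq 0 c
  have p2 := (hwT.comp (fun x => x ^ 2)).intervalIntegral_add_eq 0 c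
  simp only [zero_add, Function.comp_def] at p1 p2
  have s1 := intervalIntegral.integral_add_adjacent_intervals (iu c (c + T / 2))
    (iu (c + T / 2) (c + T))
  have s2 := intervalIntegral.integral_add_adjacent_intervals (hw2 c (c + T / 2))
    (hw2 (c + T / 2) (c + T))
  rw [p1, p2, ← s1, ← s2]
  have hk : (T / (2 * π)) ^ 2 * (π / (T / 2)) ^ 2 = 1 := by
    have := pi_pos.ne'
    field_simp
  calc _ = (T / (2 * π)) ^ 2 * ((π / (T / 2)) ^ 2 * ∫ t in c..c + T / 2, u t ^ 2) +
        (T / (2 * π)) ^ 2 * ((π / (T / 2)) ^ 2 * ∫ t in c + T / 2..c + T, u t ^ 2) := by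
        rw [← mul_assoc, ← mul_assoc, hk, one_mul, one_mul]
    _ ≤ _ := by
        rw [mul_add]
        gcongr

/-- Wirtinger's inequality for antiperiodic `H¹` loops. -/
theorem IsH1Loop.integral_norm_sq_le {k : ℕ} {T : ℝ} (hT : 0 < T)
    {x : ℝ → EuclideanSpace ℝ (Fin k)} (hx : IsH1Loop T x)
    (hanti : Function.Antiperiodic x (T / 2)) :
    Continuous x ∧ ∫ t in (0 : ℝ)..T, ‖x t‖ ^ 2 ≤
      (T / (2 * π)) ^ 2 * ∫ t in (0 : ℝ)..T, ‖deriv x t‖ ^ 2 := by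
  obtain ⟨-, v, hvm, hvT, hv2, hxv⟩ := hx
  have hvT : Function.Periodic v T := hvT
  have hv : ∀ a b, IntervalIntegrable v volume a b := by
    refine hvT.intervalIntegrable₀ hT.ne' ?_
    rw [intervalIntegrable_iff_integrableOn_Icc_of_le hT.le]
    exact ((memLp_two_iff_integrable_sq_norm hvm.restrict).2 hv2).integrable one_le_two
  have hv2 : ∀ a b, IntervalIntegrable (fun t => ‖v t‖ ^ 2) volume a b := by
    refine (hvT.comp fun y => ‖y‖ ^ 2).intervalIntegrable₀ hT.ne' ?_
    rwa [intervalIntegrable_iff_integrableOn_Icc_of_le hT.le]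
  have hx0 : x = fun t => x 0 + ∫ r in (0 : ℝ)..t, v r := by
    funext t; rw [← hxv]; abel
  have hxc : Continuous x := by
    rw [hx0]
    exact continuous_const.add (intervalIntegral.continuous_primitive hv 0)
  refine ⟨hxc, ?_⟩
  have hderiv : ∀ᵐ t, t ∈ Set.uIoc 0 T → ‖deriv x t‖ ^ 2 = ‖v t‖ ^ 2 := by
    filter_upwards [(hv 0 T).ae_hasDerivAt_integral] with t ht htm
    have h1 := (ht (Set.uIoc_subset_uIcc htm) 0 (by simp)).const_add (x 0)
    rw [← hx0] at h1
    rw [h1.deriv]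
  rw [intervalIntegral.integral_congr_ae hderiv]
  have hcoord : ∀ (n : Fin k) a b, IntervalIntegrable (fun t => v t n) volume a b := fun n a b =>
    ⟨(EuclideanSpace.proj n : _ →L[ℝ] ℝ).integrable_comp (hv a b).1,
      (EuclideanSpace.proj n : _ →L[ℝ] ℝ).integrable_comp (hv a b).2⟩
  have hcoord2 : ∀ (n : Fin k) a b, IntervalIntegrable (fun t => v t n ^ 2) volume a b := by
    intro n a b
    refine (hv2 a b).mono_fun ((hcoord n a b).def'.aestronglyMeasurable.pow 2) ?_
    refine Eventually.of_forall fun t => ?_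
    have h1 : ‖v t n‖ ≤ ‖v t‖ := PiLp.norm_apply_le (v t) n
    simp only [norm_pow, norm_norm]
    gcongr
  have hcomp : ∀ n : Fin k, ∫ t in (0 : ℝ)..T, x t n ^ 2 ≤
      (T / (2 * π)) ^ 2 * ∫ t in (0 : ℝ)..T, v t n ^ 2 := by
    intro n
    refine integral_sq_le_of_antiperiodic hT (hcoord n) (hcoord2 n) (fun t => by rw [hvT t]) ?_ ?_
    · intro s t
      have := (EuclideanSpace.proj n : _ →L[ℝ] ℝ).intervalIntegral_comp_comm (hv s t)
      rw [← hxv] at this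
      simpa using this.symm
    · intro t
      simp [hanti t]
  simp only [EuclideanSpace.real_norm_sq_eq]
  rw [intervalIntegral.integral_finsetSum, intervalIntegral.integral_finsetSum, Finset.mul_sum]
  · exact Finset.sum_le_sum fun n _ => hcomp n
  · exact fun n _ => hcoord2 n 0 T
  · intro n _
    apply Continuous.intervalIntegrable
    fun_prop

/-- Tangent-line bound for the concave power function. -/
theorem rpow_le_tangent {a A y : ℝ} (ha0 : 0 ≤ a) (ha1 : a ≤ 1) (hA : 0 < A) (hy : 0 ≤ y) :
    y ^ a ≤ (1 - a) * A ^ a + a * A ^ (a - 1) * y := by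
  have h := geom_mean_le_arith_mean2_weighted ha0 (sub_nonneg.2 ha1) hy hA.le (by ring)
  have h1 : A ^ (1 - a) * A ^ (a - 1) = 1 := by rw [← rpow_add hA]; simp
  have h2 : A * A ^ (a - 1) = A ^ a := by
    rw [mul_comm, ← rpow_add_one hA.ne']; simp
  calc y ^ a = y ^ a * A ^ (1 - a) * A ^ (a - 1) := by rw [mul_assoc, h1, mul_one]
    _ ≤ (a * y + (1 - a) * A) * A ^ (a - 1) := by gcongr
    _ = _ := by rw [← h2]; ring

/-- The tangent-line bound is attained at the base point. -/
theorem tangent_combination_eq {a P B : ℝ} (hP : 0 < P) (hB : 0 < B) :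
    (1 - a) * (B / P) ^ a * P + a * (B / P) ^ (a - 1) * B = P ^ (1 - a) * B ^ a := by
  rw [rpow_sub_one (div_pos hB hP).ne', div_rpow hB.le hP.le, rpow_sub hP, rpow_one]
  have := (rpow_pos_of_pos hP a).ne'
  field_simp
  ring

theorem sum_sum_ne_eq_two_mul_sum_Ioi {N : ℕ} (m : Fin N → ℝ) :
    (∑ i, ∑ j, if i ≠ j then m i * m j else 0) = 2 * ∑ i, ∑ j ∈ Finset.Ioi i, m i * m j := by
  have h := Finset.sum_sum_Ioi_add_eq_sum_sum_off_diag (fun i j => m i * m j)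
  calc _ = ∑ i, ∑ j ∈ {i}ᶜ, m j * m i := by
        refine Finset.sum_congr rfl fun i _ => ?_
        rw [← Finset.sum_filter]
        refine Finset.sum_congr ?_ fun j _ => mul_comm _ _
        ext j
        simp [eq_comm]
    _ = _ := by
        rw [← h, Finset.mul_sum]
        refine Finset.sum_congr rfl fun i _ => ?_
        rw [Finset.mul_sum]
        exact Finset.sum_congr rfl fun j _ => by ring

/-- Lagrange-type bound of the weighted mutual squared distances by the moment of inertia. -/
theorem sum_sum_mul_norm_sub_sq_le {N : ℕ} {E : Type*} [NormedAddCommGroup E]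
    [InnerProductSpace ℝ E] (m : Fin N → ℝ) (x : Fin N → E) :
    ∑ i, ∑ j, m i * m j * ‖x i - x j‖ ^ 2 ≤ 2 * ((∑ i, m i) * ∑ i, m i * ‖x i‖ ^ 2) := by
  have h : ∑ i, ∑ j, m i * m j * ‖x i - x j‖ ^ 2 =
      2 * ((∑ i, m i) * ∑ i, m i * ‖x i‖ ^ 2) - 2 * ‖∑ i, m i • x i‖ ^ 2 := by
    have e1 : (∑ i, m i) * ∑ i, m i * ‖x i‖ ^ 2 = ∑ i, ∑ j, m i * m j * ‖x j‖ ^ 2 := by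
      rw [Finset.sum_mul_sum]
      exact Finset.sum_congr rfl fun i _ => Finset.sum_congr rfl fun j _ => by ring
    have e2 : (∑ i, m i) * ∑ i, m i * ‖x i‖ ^ 2 = ∑ i, ∑ j, m i * m j * ‖x i‖ ^ 2 := by
      rw [e1, Finset.sum_comm]
      exact Finset.sum_congr rfl fun i _ => Finset.sum_congr rfl fun j _ => by ring
    have e3 : ‖∑ i, m i • x i‖ ^ 2 = ∑ i, ∑ j, m i * m j * inner ℝ (x i) (x j) := by
      rw [← real_inner_self_eq_norm_sq, sum_inner]
      refine Finset.sum_congr rfl fun i _ => ?_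
      rw [inner_sum]
      refine Finset.sum_congr rfl fun j _ => ?_
      rw [real_inner_smul_left, real_inner_smul_right]
      ring
    rw [two_mul]
    nth_rw 1 [e1]
    rw [e2, e3, Finset.mul_sum, ← Finset.sum_add_distrib, ← Finset.sum_sub_distrib]
    refine Finset.sum_congr rfl fun i _ => ?_
    rw [Finset.mul_sum, ← Finset.sum_add_distrib, ← Finset.sum_sub_distrib]
    refine Finset.sum_congr rfl fun j _ => ?_
    rw [norm_sub_sq_real]
    ring
  rw [h]
  nlinarith [sq_nonneg ‖∑ i, m i • x i‖]

/-- The pairwise growth bound, linearised at the base point `A`. -/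
theorem Vtot_le {N k : ℕ} {m : Fin N → ℝ} (hm : ∀ i, 0 < m i) {g θ r A : ℝ}
    (hg : 0 < g) (hθ0 : 0 ≤ θ) (hθ2 : θ < 2) (hA : 0 < A)
    {Vij : Fin N → Fin N → ℝ → EuclideanSpace ℝ (Fin k) → ℝ}
    (hgrow : ∀ i j, i ≠ j → ∀ (t : ℝ) (ξ : EuclideanSpace ℝ (Fin k)), r < ‖ξ‖ →
      Vij i j t ξ ≤ g * m i * m j * ‖ξ‖ ^ θ)
    (t : ℝ) {x : Fin N → EuclideanSpace ℝ (Fin k)}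
    (hsep : ∀ i j, i ≠ j → r < ‖x i - x j‖) :
    Vtot Vij t x ≤ g * ((1 - θ / 2) * A ^ (θ / 2) * ∑ i, ∑ j ∈ Finset.Ioi i, m i * m j) +
      g * (θ / 2 * A ^ (θ / 2 - 1) * (∑ i, m i)) * ∑ i, m i * ‖x i‖ ^ 2 := by
  have hterm : ∀ i j, (if i ≠ j then Vij i j t (x i - x j) else 0) ≤
      g * (1 - θ / 2) * A ^ (θ / 2) * (if i ≠ j then m i * m j else 0) +
        g * (θ / 2) * A ^ (θ / 2 - 1) * (m i * m j * ‖x i - x j‖ ^ 2) := by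
    intro i j
    by_cases hij : i = j
    · simp [hij]
    · rw [if_pos hij, if_pos hij]
      have h1 : ‖x i - x j‖ ^ θ = (‖x i - x j‖ ^ 2) ^ (θ / 2) := by
        rw [← rpow_natCast, ← rpow_mul (norm_nonneg _)]
        congr 1
        push_cast
        ring
      have h2 := rpow_le_tangent (a := θ / 2) (by linarith) (by linarith) hA
        (sq_nonneg ‖x i - x j‖)
      have h3 : 0 ≤ g * m i * m j := by have := hm i; have := hm j; positivity
      refine (hgrow i j hij t _ (hsep i j hij)).trans ?_
      rw [h1]
      refine (mul_le_mul_of_nonneg_left h2 h3).trans_eq ?_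
      ring
  have hsum := Finset.sum_le_sum fun i (_ : i ∈ Finset.univ) =>
    Finset.sum_le_sum fun j (_ : j ∈ Finset.univ) => hterm i j
  simp only [Finset.sum_add_distrib, ← Finset.mul_sum] at hsum
  rw [sum_sum_ne_eq_two_mul_sum_Ioi] at hsum
  have hlag := mul_le_mul_of_nonneg_left (sum_sum_mul_norm_sub_sq_le m x)
    (show 0 ≤ g * (θ / 2) * A ^ (θ / 2 - 1) by positivity)
  unfold Vtot
  linarith

theorem sum_Ioi_mul_pos {N : ℕ} (hN : 2 ≤ N) {m : Fin N → ℝ} (hm : ∀ i, 0 < m i) :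
    0 < ∑ i, ∑ j ∈ Finset.Ioi i, m i * m j := by
  have h0 : ∀ i, 0 ≤ ∑ j ∈ Finset.Ioi i, m i * m j := fun i =>
    Finset.sum_nonneg fun j _ => (mul_pos (hm i) (hm j)).le
  refine Finset.sum_pos' (fun i _ => h0 i) ⟨⟨0, by omega⟩, Finset.mem_univ _, ?_⟩
  refine Finset.sum_pos (fun j _ => mul_pos (hm _) (hm j)) ⟨⟨1, by omega⟩, ?_⟩
  simp

/-- Mutual separation bounds the moment of inertia from below. -/
theorem sum_Ioi_mul_sq_le {N : ℕ} {E : Type*} [NormedAddCommGroup E] [InnerProductSpace ℝ E]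
    {m : Fin N → ℝ} (hm : ∀ i, 0 < m i) {r : ℝ} (hr : 0 < r) {x : Fin N → E}
    (hsep : ∀ i j, i ≠ j → r < ‖x i - x j‖) :
    (∑ i, ∑ j ∈ Finset.Ioi i, m i * m j) * r ^ 2 ≤ (∑ i, m i) * ∑ i, m i * ‖x i‖ ^ 2 := by
  have h1 : (∑ i, ∑ j, if i ≠ j then m i * m j else 0) * r ^ 2 ≤
      ∑ i, ∑ j, m i * m j * ‖x i - x j‖ ^ 2 := by
    simp only [Finset.sum_mul]
    refine Finset.sum_le_sum fun i _ => Finset.sum_le_sum fun j _ => ?_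
    by_cases hij : i = j
    · simp [hij]
    · rw [if_pos hij]
      have := mul_pos (hm i) (hm j)
      have := hsep i j hij
      gcongr
  rw [sum_sum_ne_eq_two_mul_sum_Ioi] at h1
  linarith [sum_sum_mul_norm_sub_sq_le m x]

theorem coercivity_away_from_collisions
    {N k : ℕ} (hN : 2 ≤ N) (hk : 2 ≤ k)
    (T : ℝ) (hT : 0 < T)
    (m : Fin N → ℝ) (hm : ∀ i, 0 < m i)
    (g θ r : ℝ) (hg : 0 < g) (hθ0 : 0 ≤ θ) (hθ2 : θ < 2) (hr : 0 < r)
    (Vij : Fin N → Fin N → ℝ → EuclideanSpace ℝ (Fin k) → ℝ)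
    -- each `V_{ij}` is `C¹` on `ℝ × (ℝ^k ∖ {0})`, `T`-periodic in `t`
    (hC1 : ∀ i j, i ≠ j →
      ContDiffOn ℝ 1 (fun p : ℝ × EuclideanSpace ℝ (Fin k) => Vij i j p.1 p.2)
        (Set.univ ×ˢ {(0 : EuclideanSpace ℝ (Fin k))}ᶜ))
    (hper : ∀ i j t ξ, Vij i j (t + T) ξ = Vij i j t ξ)
    -- the sub-quadratic growth bound
    (hgrow : ∀ i j, i ≠ j → ∀ (t : ℝ) (ξ : EuclideanSpace ℝ (Fin k)), r < ‖ξ‖ →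
      Vij i j t ξ ≤ g * m i * m j * ‖ξ‖ ^ θ)
    -- `X` is an antiperiodic `H¹` loop staying away from collisions
    (X : ℝ → Fin N → EuclideanSpace ℝ (Fin k))
    (hXH1 : ∀ i, IsH1Loop T fun t => X t i)
    (hXanti : ∀ t i, X (t + T / 2) i = -X t i)
    (hXsep : ∀ t ∈ Set.Icc (0:ℝ) T, ∀ i j, i ≠ j → r < ‖X t i - X t j‖) :
    action T m Vij X ≥ kinetic T m X -
      (g * (∑ i, ∑ j ∈ Finset.Ioi i, m i * m j) ^ ((2 - θ) / 2) *
        (∑ i, m i) ^ (θ / 2) * (T / (2 * π)) ^ θ * T ^ (1 - θ / 2) *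
          (2:ℝ) ^ (θ / 2)) * kinetic T m X ^ (θ / 2) := by
  set p := ∑ i, ∑ j ∈ Finset.Ioi i, m i * m j
  set M := ∑ i, m i
  set K := kinetic T m X with hK
  have hXanti' : ∀ i, Function.Antiperiodic (fun t => X t i) (T / 2) := fun i t => hXanti t i
  have hXc : ∀ i, Continuous fun t => X t i := fun i =>
    ((hXH1 i).integral_norm_sq_le hT (hXanti' i)).1
  have hp0 : 0 < p := sum_Ioi_mul_pos hN hm
  have hM0 : 0 < M := Finset.sum_pos (fun i _ => hm i) ⟨⟨0, by omega⟩, Finset.mem_univ _⟩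
  have hDc : Continuous fun t => ∑ i, m i * ‖X t i‖ ^ 2 :=
    continuous_finsetSum _ fun i _ => continuous_const.mul ((hXc i).norm.pow 2)
  have hDi : ∀ c : ℝ, IntervalIntegrable (fun t => c * ∑ i, m i * ‖X t i‖ ^ 2) volume 0 T :=
    fun c => (continuous_const.mul hDc).intervalIntegrable 0 T
  have hDK : ∫ t in (0 : ℝ)..T, ∑ i, m i * ‖X t i‖ ^ 2 ≤ (T / (2 * π)) ^ 2 * (2 * K) := by
    have hi : ∀ i ∈ Finset.univ,
        IntervalIntegrable (fun t => m i * ‖X t i‖ ^ 2) volume 0 T := fun i _ =>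
      (continuous_const.mul ((hXc i).norm.pow 2)).intervalIntegrable _ _
    rw [intervalIntegral.integral_finsetSum hi, hK, kinetic, Finset.mul_sum, Finset.mul_sum]
    refine Finset.sum_le_sum fun i _ => ?_
    rw [intervalIntegral.integral_const_mul]
    have h := mul_le_mul_of_nonneg_left
      ((hXH1 i).integral_norm_sq_le hT (hXanti' i)).2 (hm i).le
    linarith
  set B := M * ((T / (2 * π)) ^ 2 * (2 * K)) with hB
  have hDB : M * ∫ t in (0 : ℝ)..T, ∑ i, m i * ‖X t i‖ ^ 2 ≤ B :=
    mul_le_mul_of_nonneg_left hDK hM0.le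
  have hpr : p * r ^ 2 * T ≤ M * ∫ t in (0 : ℝ)..T, ∑ i, m i * ‖X t i‖ ^ 2 := by
    have h := intervalIntegral.integral_mono_on hT.le
      (intervalIntegrable_const (c := p * r ^ 2) (μ := volume))
      (hDi M) fun t ht => sum_Ioi_mul_sq_le hm hr (hXsep t ht)
    rw [intervalIntegral.integral_const, intervalIntegral.integral_const_mul] at h
    simpa [mul_comm T] using h
  have hB0 : 0 < B := lt_of_lt_of_le (by positivity) (hpr.trans hDB)
  have hτ : 0 < T / (2 * π) := by positivity
  have hK0 : 0 < K := by
    by_contra! hneg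
    have : B ≤ 0 := mul_nonpos_of_nonneg_of_nonpos hM0.le
      (mul_nonpos_of_nonneg_of_nonpos (sq_nonneg _) (by linarith))
    linarith
  have hP0 : 0 < p * T := mul_pos hp0 hT
  set A := B / (p * T)
  have hA0 : 0 < A := div_pos hB0 hP0
  have hVc : ContinuousOn (fun t => Vtot Vij t (X t)) (Set.Icc 0 T) := by
    refine continuousOn_const.mul
      (continuousOn_finsetSum _ fun i _ => continuousOn_finsetSum _ fun j _ => ?_)
    by_cases hij : i = j
    · simpa [hij] using continuousOn_const
    · simp only [ne_eq, hij, not_false_eq_true, if_true]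
      refine (hC1 i j hij).continuousOn.comp
        (continuous_id.prodMk ((hXc i).sub (hXc j))).continuousOn fun t ht => ?_
      have h := hr.trans (hXsep t ht i j hij)
      exact ⟨Set.mem_univ _, norm_pos_iff.1 h⟩
  have hV : ∫ t in (0 : ℝ)..T, Vtot Vij t (X t) ≤
      g * ((1 - θ / 2) * A ^ (θ / 2) * (p * T) + θ / 2 * A ^ (θ / 2 - 1) * B) := by
    have h := intervalIntegral.integral_mono_on hT.le
      (hVc.intervalIntegrable_of_Icc hT.le)
      (intervalIntegrable_const.add (hDi _))
      fun t ht => Vtot_le hm hg hθ0 hθ2 hA0 hgrow t (hXsep t ht)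
    rw [intervalIntegral.integral_add intervalIntegrable_const (hDi _), intervalIntegral.integral_const,
      intervalIntegral.integral_const_mul, smul_eq_mul, sub_zero] at h
    have h2 := mul_le_mul_of_nonneg_left hDB
      (show 0 ≤ g * (θ / 2 * A ^ (θ / 2 - 1)) by positivity)
    linarith
  rw [tangent_combination_eq hP0 hB0] at hV
  have hBθ : B ^ (θ / 2) = M ^ (θ / 2) * ((T / (2 * π)) ^ θ * (2 ^ (θ / 2) * K ^ (θ / 2))) := by
    rw [hB, mul_rpow hM0.le (by positivity), mul_rpow (by positivity) (by positivity),
      mul_rpow zero_le_two hK0.le, ← rpow_natCast, ← rpow_mul hτ.le]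
    congr 4
    push_cast
    ring
  rw [hBθ, mul_rpow hp0.le hT.le, show 1 - θ / 2 = (2 - θ) / 2 by ring] at hV
  rw [show 1 - θ / 2 = (2 - θ) / 2 by ring]
  unfold action
  rw [← hK]
  linarith

end
end
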